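/- arXiv:2209.05988 — 2 statements merged into one kernel-verified Lean document; each statement's English description precedes it below -/
import Mathlib

section
/- Let γ: ℝ/L → ℝ³ be a minimal inspection curve, let t ∈ ℝ/L be a regular point of γ, and let ℓ be the tangent line of γ at t. Suppose ℓ intersects the interior of conv(γ). Then there exists an open interval U ⊂ ℝ/L with t ∈ U that is mapped injectively by γ into ℓ ∩ int(conv(γ)). -/
open Real Set MeasureTheory ENNReal

noncomputable section


noncomputable section

abbrev E3 := EuclideanSpace ℝ (Fin 3)

/-- The lift of a curve `γ : ℝ/L → ℝ³` to `ℝ`, via the quotient map `ℝ → ℝ/L`. -/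
def liftCurve (L : ℝ) (γ : AddCircle L → E3) : ℝ → E3 := fun s => γ s

/-- An inspection curve is a closed rectifiable curve `γ : ℝ/L → ℝ³`, parameterized with
constant unit speed (`1`-Lipschitz with total variation `L` over one period), whose convex
hull contains the unit sphere centered at the origin. -/
def IsInspectionCurve (L : ℝ) (γ : AddCircle L → E3) : Prop :=
  0 < L ∧ Continuous γ ∧ LipschitzWith 1 (liftCurve L γ) ∧
    eVariationOn (liftCurve L γ) (Set.Icc 0 L) = ENNReal.ofReal L ∧
    Metric.sphere (0 : E3) 1 ⊆ convexHull ℝ (Set.range γ)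

/-- A minimal inspection curve is an inspection curve of minimal length. -/
def IsMinInspectionCurve (L : ℝ) (γ : AddCircle L → E3) : Prop :=
  IsInspectionCurve L γ ∧
    ∀ (L' : ℝ) (γ' : AddCircle L' → E3), IsInspectionCurve L' γ' → L ≤ L'

/-- In finite dimension, the convex hull of a compact set is compact. -/
theorem IsCompact.convexHull_of_finiteDimensional {E : Type*} [NormedAddCommGroup E]
    [NormedSpace ℝ E] [FiniteDimensional ℝ E] {s : Set E} (hs : IsCompact s) :
    IsCompact (convexHull ℝ s) := by
  set n := Module.finrank ℝ E + 1
  let Φ : (Fin n → ℝ) × (Fin n → E) → E := fun q => ∑ i, q.1 i • q.2 i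
  have hΦ : Continuous Φ := by fun_prop
  have hcomp : IsCompact (stdSimplex ℝ (Fin n) ×ˢ Set.univ.pi fun _ : Fin n => s) :=
    (isCompact_stdSimplex ℝ (Fin n)).prod (isCompact_univ_pi fun _ => hs)
  convert hcomp.image hΦ
  apply Set.Subset.antisymm
  · intro x hx
    obtain ⟨ι, _, z, w, hz, hind, hw, hsum, rfl⟩ := eq_pos_convex_span_of_mem_convexHull hx
    have hcard : Fintype.card ι ≤ Fintype.card (Fin n) := by
      rw [Fintype.card_fin]
      exact hind.card_le_finrank_succ.trans
        (Nat.succ_le_succ (Submodule.finrank_le _))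
    obtain ⟨e⟩ := Function.Embedding.nonempty_of_card_le hcard
    obtain ⟨p, hp⟩ := convexHull_nonempty_iff.1 ⟨_, hx⟩
    have hw' : ∀ i, Function.extend e w 0 (e i) = w i := fun i => e.injective.extend_apply _ _ _
    have hz' : ∀ i, Function.extend e z (fun _ => p) (e i) = z i :=
      fun i => e.injective.extend_apply _ _ _
    have hw0 : ∀ j, j ∉ Set.range e → Function.extend e w 0 j = 0 := fun j hj =>
      Function.extend_apply' _ _ _ hj
    refine ⟨(Function.extend e w 0, Function.extend e z fun _ => p), ⟨⟨fun j => ?_, ?_⟩, ?_⟩, ?_⟩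
    · by_cases hj : j ∈ Set.range e
      · obtain ⟨i, rfl⟩ := hj
        simpa only [hw'] using (hw i).le
      · exact (hw0 j hj).ge
    · rw [← hsum]
      exact (Fintype.sum_of_injective e e.injective _ _ hw0 fun i => (hw' i).symm).symm
    · intro j _
      by_cases hj : j ∈ Set.range e
      · obtain ⟨i, rfl⟩ := hj
        simpa only [hz'] using hz ⟨i, rfl⟩
      · simpa only [Function.extend_apply' _ _ _ hj] using hp
    · refine (Fintype.sum_of_injective e e.injective _ _ (fun j hj => ?_) fun i => ?_).symm
      · simp only [hw0 j hj, zero_smul]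
      · simp only [hw', hz']
  · rintro _ ⟨⟨w, z⟩, ⟨⟨hw, hsum⟩, hz⟩, rfl⟩
    exact (convex_convexHull ℝ s).sum_mem (fun i _ => hw i) hsum
      fun i _ => subset_convexHull ℝ s (hz i (Set.mem_univ i))

/-- The convex hull of a compact set is already spanned by the points of the set which do not lie
in the interior of the hull. -/
theorem convexHull_subset_of_sdiff_interior_subset {E : Type*} [NormedAddCommGroup E]
    [NormedSpace ℝ E] [FiniteDimensional ℝ E] [Nontrivial E] {s s' : Set E} (hs : IsCompact s)
    (hs' : IsCompact s') (h : s \ interior (convexHull ℝ s) ⊆ s') :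
    convexHull ℝ s ⊆ convexHull ℝ s' := by
  rw [← closure_convexHull_extremePoints hs.convexHull_of_finiteDimensional
    (convex_convexHull ℝ s)]
  refine closure_minimal (convexHull_mono fun x hx => h ⟨extremePoints_convexHull_subset hx, ?_⟩)
    hs'.convexHull_of_finiteDimensional.isClosed
  exact fun hxi => Set.disjoint_left.1 (disjoint_interior_extremePoints _) hxi hx

/-- If a tangent line of a curve in a convex set `K` meets the interior of `K`, then the point of
tangency is in the interior of `K`. -/
theorem mem_interior_of_tangent_mem_interior {E : Type*} [NormedAddCommGroup E] [NormedSpace ℝ E]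
    {K : Set E} (hK : Convex ℝ K) {f : ℝ → E} (hf : ∀ s, f s ∈ K) {t u : ℝ} {v : E}
    (hv : HasDerivAt f v t) (hu : f t + u • v ∈ interior K) : f t ∈ interior K := by
  have hline : HasDerivAt (fun k : ℝ => t - k * u) (-u) 0 := by
    simpa using ((hasDerivAt_id (0 : ℝ)).mul_const u).const_sub t
  have hcomp : HasDerivAt (fun k : ℝ => f (t - k * u)) ((-u) • v) 0 :=
    HasDerivAt.scomp (0 : ℝ) (by simpa using hv) hline
  have htend := (hcomp.tendsto_slope_zero_right).const_sub (f t)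
  simp only [zero_add, zero_mul, sub_zero, neg_smul, sub_neg_eq_add] at htend
  obtain ⟨k, hkint, hk⟩ := ((htend.eventually (isOpen_interior.mem_nhds hu)).and
    self_mem_nhdsWithin).exists
  have hk : 0 < k := hk
  have hk1 : 0 < 1 + k := by linarith
  have := hK.combo_interior_self_mem_interior hkint (hf (t - k * u)) (a := k / (1 + k))
    (b := 1 / (1 + k)) (by positivity) (by positivity) (by field_simp; ring)
  convert this using 1
  rw [smul_sub, smul_smul, smul_sub]
  have h1 : k / (1 + k) * k⁻¹ = 1 / (1 + k) := by field_simp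
  have h2 : f t = (k / (1 + k)) • f t + (1 / (1 + k)) • f t := by
    rw [← add_smul]
    have : k / (1 + k) + 1 / (1 + k) = 1 := by field_simp; ring
    rw [this, one_smul]
  rw [h1]
  nth_rewrite 1 [h2]
  abel

theorem LipschitzWith.eVariationOn_Icc_le {E : Type*} [PseudoEMetricSpace E] {f : ℝ → E}
    (hf : LipschitzWith 1 f) {x y : ℝ} (hxy : x ≤ y) :
    eVariationOn f (Set.Icc x y) ≤ ENNReal.ofReal (y - x) := by
  have h := (hf.lipschitzOnWith (s := Set.univ)).comp_eVariationOn_le (g := id) (s := Set.Icc x y)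
    (Set.mapsTo_univ _ _)
  refine h.trans ?_
  have h2 := (monotone_id.monotoneOn (Set.Icc x y)).eVariationOn_eq (Set.left_mem_Icc.2 hxy)
    (Set.right_mem_Icc.2 hxy)
  rw [Set.inter_self] at h2
  simp [h2]

theorem eVariationOn_Icc_add_Icc {E : Type*} [PseudoEMetricSpace E] (f : ℝ → E) {x y z : ℝ}
    (hxy : x ≤ y) (hyz : y ≤ z) :
    eVariationOn f (Set.Icc x y) + eVariationOn f (Set.Icc y z) =
      eVariationOn f (Set.Icc x z) := by
  simpa using eVariationOn.Icc_add_Icc f (s := Set.univ) hxy hyz (Set.mem_univ y)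

/-- A `1`-Lipschitz curve of full variation on an interval has full variation on subintervals. -/
theorem LipschitzWith.le_eVariationOn_Icc_of_subinterval {E : Type*} [PseudoEMetricSpace E]
    {f : ℝ → E} (hf : LipschitzWith 1 f) {p x y q : ℝ} (hpx : p ≤ x) (hxy : x ≤ y) (hyq : y ≤ q)
    (h : ENNReal.ofReal (q - p) ≤ eVariationOn f (Set.Icc p q)) :
    ENNReal.ofReal (y - x) ≤ eVariationOn f (Set.Icc x y) := by
  rw [← eVariationOn_Icc_add_Icc f hpx (hxy.trans hyq), ← eVariationOn_Icc_add_Icc f hxy hyq] at h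
  have h1 := hf.eVariationOn_Icc_le hpx
  have h2 := hf.eVariationOn_Icc_le hyq
  have h3 : ENNReal.ofReal (q - p) =
      ENNReal.ofReal (x - p) + (ENNReal.ofReal (y - x) + ENNReal.ofReal (q - y)) := by
    rw [← ENNReal.ofReal_add (by linarith) (by linarith),
      ← ENNReal.ofReal_add (by linarith) (by linarith)]
    congr 1
    ring
  have h4 := h3 ▸ h.trans (add_le_add h1 (add_le_add_right h2 _))
  rw [ENNReal.add_le_add_iff_left ENNReal.ofReal_ne_top,
    ENNReal.add_le_add_iff_right ENNReal.ofReal_ne_top] at h4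
  exact h4

/-- A periodic `1`-Lipschitz curve with full variation on `[0, L]` has full variation on
every interval of length at most one period. -/
theorem Function.Periodic.le_eVariationOn_Icc {E : Type*} [PseudoEMetricSpace E]
    {f : ℝ → E} {L : ℝ} (hper : Function.Periodic f L) (hL : 0 < L) (hf : LipschitzWith 1 f)
    (hvar : eVariationOn f (Set.Icc 0 L) = ENNReal.ofReal L) {x y : ℝ} (hxy : x ≤ y)
    (hyx : y ≤ x + L) : ENNReal.ofReal (y - x) ≤ eVariationOn f (Set.Icc x y) := by
  have htrans : ∀ k : ℤ, eVariationOn f (Set.Icc (k * L) (k * L + L)) = ENNReal.ofReal L := by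
    intro k
    have h := eVariationOn.comp_eq_of_monotoneOn f (t := Set.Icc 0 L) (fun r => r + k * L)
      fun a _ b _ hab => by simpa using hab
    have hfk : f ∘ (fun r => r + k * L) = f := by
      funext r
      simpa using hper.int_mul k r
    rw [hfk, hvar, Set.image_add_const_Icc, zero_add, add_comm L] at h
    exact h.symm
  obtain ⟨k, ⟨hk1, hk2⟩, -⟩ := existsUnique_add_zsmul_mem_Ico hL x 0
  have hlow : (((-k : ℤ) : ℝ)) * L ≤ x := by
    push_cast
    simp only [zsmul_eq_mul] at hk1
    linarith
  have hupp : x ≤ (((-k : ℤ) : ℝ)) * L + L := by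
    push_cast
    simp only [zsmul_eq_mul] at hk2
    linarith
  set j : ℤ := -k
  have hj := htrans j
  have hj1 := htrans (j + 1)
  push_cast at hj1
  rw [add_one_mul] at hj1
  have hdouble : ENNReal.ofReal (j * L + L + L - j * L) ≤
      eVariationOn f (Set.Icc (j * L) (j * L + L + L)) := by
    rw [← eVariationOn_Icc_add_Icc f (y := j * L + L) (by linarith) (by linarith), hj, hj1,
      ← ENNReal.ofReal_add hL.le hL.le]
    apply le_of_eq
    congr 1
    ring
  exact hf.le_eVariationOn_Icc_of_subinterval hlow hxy (by linarith) hdouble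

/-- The periodic extension of a `1`-Lipschitz curve closing up after time `p` is `1`-Lipschitz. -/
theorem lipschitzWith_comp_toIcoMod {E : Type*} [PseudoMetricSpace E] {h : ℝ → E}
    (hh : LipschitzWith 1 h) {p : ℝ} (hp : 0 < p) (hclosed : h p = h 0) :
    LipschitzWith 1 fun s => h (toIcoMod hp 0 s) := by
  refine LipschitzWith.of_dist_le_mul fun x y => ?_
  rw [NNReal.coe_one, one_mul]
  wlog hxy : x ≤ y generalizing x y
  · rw [dist_comm, dist_comm x]
    exact this y x (le_of_not_ge hxy)
  have hd : ∀ a b, dist (h a) (h b) ≤ |a - b| := fun a b => by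
    simpa [Real.dist_eq] using hh.dist_le_mul a b
  have hx := toIcoMod_mem_Ico hp 0 x
  have hy := toIcoMod_mem_Ico hp 0 y
  have ex := toIcoMod_add_toIcoDiv_zsmul hp 0 x
  have ey := toIcoMod_add_toIcoDiv_zsmul hp 0 y
  set a := toIcoMod hp 0 x
  set b := toIcoMod hp 0 y
  set m := toIcoDiv hp 0 x
  set n := toIcoDiv hp 0 y
  simp only [zsmul_eq_mul, zero_add] at ex ey hx hy
  rw [Real.dist_eq, abs_sub_comm, abs_of_nonneg (sub_nonneg.2 hxy)]
  have hdiv : m ≤ n := by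
    by_contra! hlt
    have hcast : (n : ℝ) + 1 ≤ m := by exact_mod_cast hlt
    have hmul : ((n : ℝ) + 1) * p ≤ m * p := mul_le_mul_of_nonneg_right hcast hp.le
    linarith [hx.1, hy.2]
  rcases hdiv.eq_or_lt with hmn | hmn
  · rw [hmn] at ex
    have : y - x = b - a := by linarith
    calc dist (h a) (h b) ≤ |a - b| := hd a b
      _ = y - x := by rw [abs_sub_comm, ← this, abs_of_nonneg (sub_nonneg.2 hxy)]
  · have hcast : (m : ℝ) + 1 ≤ n := by exact_mod_cast hmn
    have hmul : ((m : ℝ) + 1) * p ≤ n * p := mul_le_mul_of_nonneg_right hcast hp.le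
    calc dist (h a) (h b) ≤ dist (h a) (h p) + dist (h 0) (h b) := by
          rw [← hclosed]; exact dist_triangle _ _ _
      _ ≤ |a - p| + |0 - b| := add_le_add (hd _ _) (hd _ _)
      _ = (p - a) + b := by
          rw [abs_of_nonpos (by linarith [hx.2]), zero_sub, abs_neg, abs_of_nonneg hy.1]
          ring
      _ ≤ y - x := by linarith

/-- A closed `1`-Lipschitz curve on `[0, p]` of full variation whose convex hull contains the unit
sphere bounds the length of minimal inspection curves. -/
theorem IsMinInspectionCurve.le_of_closed {L : ℝ} {γ : AddCircle L → E3}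
    (hγ : IsMinInspectionCurve L γ) {p : ℝ} (hp : 0 < p) {h : ℝ → E3} (hh : LipschitzWith 1 h)
    (hclosed : h p = h 0) (hvar : ENNReal.ofReal p ≤ eVariationOn h (Set.Icc 0 p))
    (hhull : Metric.sphere (0 : E3) 1 ⊆ convexHull ℝ (h '' Set.Icc 0 p)) : L ≤ p := by
  have hper : Function.Periodic (fun s => h (toIcoMod hp 0 s)) p := fun s => by
    simp only [toIcoMod_add_right]
  have hlip := lipschitzWith_comp_toIcoMod hh hp hclosed
  have heq : Set.EqOn h (fun s => h (toIcoMod hp 0 s)) (Set.Icc 0 p) := by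
    intro s hs
    rcases hs.2.eq_or_lt with rfl | hlt
    · simpa [hclosed] using (hper 0).symm
    · simp only [(toIcoMod_eq_self hp).2 ⟨hs.1, by simpa using hlt⟩]
  refine hγ.2 p hper.lift ⟨hp, continuous_quot_lift _ hlip.continuous, hlip, ?_, ?_⟩
  · refine le_antisymm ((hlip.eVariationOn_Icc_le hp.le).trans (by rw [sub_zero])) (hvar.trans ?_)
    exact (eVariationOn.eq_of_eqOn heq).le
  · refine hhull.trans (convexHull_mono ?_)
    rintro _ ⟨s, hs, rfl⟩
    exact ⟨(s : AddCircle p), (heq hs).symm⟩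

/-- The curve `g`, followed up to time `m` and then continued along the straight segment of
direction `w` with unit speed. -/
def followThenSegment {E : Type*} [NormedAddCommGroup E] [NormedSpace ℝ E] (g : ℝ → E) (m : ℝ)
    (w : E) (s : ℝ) : E :=
  g (min s m) + (max (s - m) 0 / ‖w‖) • w

theorem lipschitzWith_followThenSegment {E : Type*} [NormedAddCommGroup E] [NormedSpace ℝ E]
    {g : ℝ → E} (hg : LipschitzWith 1 g) (m : ℝ) (w : E) :
    LipschitzWith 1 (followThenSegment g m w) := by
  refine LipschitzWith.of_dist_le_mul fun x y => ?_
  rw [NNReal.coe_one, one_mul]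
  have hgd : dist (g (min x m)) (g (min y m)) ≤ |min x m - min y m| := by
    simpa [Real.dist_eq] using hg.dist_le_mul (min x m) (min y m)
  have hseg : dist ((max (x - m) 0 / ‖w‖) • w) ((max (y - m) 0 / ‖w‖) • w) ≤
      |max (x - m) 0 - max (y - m) 0| := by
    rw [dist_eq_norm, ← sub_smul, ← sub_div, norm_smul, norm_div, norm_norm, Real.norm_eq_abs]
    rcases (norm_nonneg w).eq_or_lt with h0 | h0
    · simp [← h0]
    · rw [div_mul_cancel₀ _ h0.ne']
  refine (dist_add_add_le _ _ _ _).trans ((add_le_add hgd hseg).trans ?_)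
  rw [Real.dist_eq]
  rcases le_total x m with hx | hx <;> rcases le_total y m with hy | hy <;>
    simp only [hx, hy, min_eq_left, min_eq_right, max_eq_left, max_eq_right, sub_nonneg,
      sub_nonpos] <;>
    grind

/-- Along a minimal inspection curve, an arc in the interior of the convex hull is a segment. -/
theorem IsMinInspectionCurve.dist_eq_of_arc_mem_interior {L : ℝ} {γ : AddCircle L → E3}
    (hγ : IsMinInspectionCurve L γ) {a b : ℝ} (hab : a ≤ b) (hbL : b < a + L)
    (h_interior : ∀ s ∈ Set.Ioo a b, liftCurve L γ s ∈ interior (convexHull ℝ (Set.range γ))) :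
    dist (liftCurve L γ a) (liftCurve L γ b) = b - a := by
  obtain ⟨hL, hcont, hlip, hvar, hhull⟩ := hγ.1
  have : Fact (0 < L) := ⟨hL⟩
  set f := liftCurve L γ with hf
  have hper : Function.Periodic f L := fun s => by simp [hf, liftCurve]
  have hle : dist (f a) (f b) ≤ b - a := by
    have := hlip.dist_le_mul a b
    rwa [NNReal.coe_one, one_mul, dist_comm a, Real.dist_eq,
      abs_of_nonneg (sub_nonneg.2 hab)] at this
  refine le_antisymm hle ?_
  set m := L - (b - a) with hm
  have hm0 : 0 < m := by linarith
  set g : ℝ → E3 := fun s => f (b + s) with hg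
  have hglip : LipschitzWith 1 g := by
    have := hlip.comp ((isometry_add_left b).lipschitz)
    rwa [mul_one] at this
  have hgm : g m = f a := by
    have : b + m = a + L := by rw [hm]; ring
    rw [hg]
    simp only [this, hper a]
  have hg0 : g 0 = f b := by simp [hg]
  set w := g 0 - g m with hw
  have hD : ‖w‖ = dist (f a) (f b) := by rw [hw, hg0, hgm, dist_comm, dist_eq_norm]
  set h := followThenSegment g m w with hh
  have hhlip : LipschitzWith 1 h := lipschitzWith_followThenSegment hglip m w
  have hhg : ∀ s ∈ Set.Icc 0 m, h s = g s := fun s hs => by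
    simp [hh, followThenSegment, hs.2]
  have hhp : h (m + ‖w‖) = g 0 := by
    have : (‖w‖ / ‖w‖) • w = w := by
      rcases eq_or_ne w 0 with h0 | h0
      · simp [h0]
      · rw [div_self (norm_ne_zero_iff.2 h0), one_smul]
    simp only [hh, followThenSegment, add_sub_cancel_left, max_eq_left (norm_nonneg w), this,
      min_eq_right (le_add_of_nonneg_right (norm_nonneg w) : m ≤ m + ‖w‖)]
    simp [hw]
  have hh0 : h 0 = g 0 := hhg 0 ⟨le_rfl, hm0.le⟩
  have hp : 0 < m + ‖w‖ := by positivity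
  have key : L ≤ m + ‖w‖ := by
    refine hγ.le_of_closed hp hhlip (hhp.trans hh0.symm) ?_ ?_
    · rw [← eVariationOn_Icc_add_Icc h hm0.le (le_add_of_nonneg_right (norm_nonneg w)),
        ENNReal.ofReal_add hm0.le (norm_nonneg w)]
      refine add_le_add ?_ ?_
      · rw [eVariationOn.eq_of_eqOn hhg]
        have h1 := hper.le_eVariationOn_Icc hL hlip hvar (x := b) (y := b + m) (by linarith)
          (by linarith)
        have h2 := eVariationOn.comp_eq_of_monotoneOn f (t := Set.Icc 0 m) (fun r => b + r)
          fun c _ d _ hcd => by simpa using hcd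
        rw [Set.image_const_add_Icc, add_zero] at h2
        rw [add_sub_cancel_left, ← h2] at h1
        exact h1
      · have h1 := eVariationOn.edist_le h (s := Set.Icc m (m + ‖w‖)) (x := m + ‖w‖) (y := m)
          ⟨by linarith [norm_nonneg w], le_rfl⟩ ⟨le_rfl, by linarith [norm_nonneg w]⟩
        rw [hhp, hhg m ⟨hm0.le, le_rfl⟩, edist_dist, dist_eq_norm] at h1
        exact h1
    · refine hhull.trans (convexHull_subset_of_sdiff_interior_subset (isCompact_range hcont)
        (isCompact_Icc.image hhlip.continuous) ?_)
      rintro _ ⟨⟨q, rfl⟩, hq⟩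
      obtain ⟨r, hr⟩ := QuotientAddGroup.mk_surjective q
      have hγr : γ q = f r := by rw [hf, ← hr]; rfl
      obtain ⟨r', hr', hrr'⟩ := hper.exists_mem_Ico hL r b
      rw [hγr, hrr'] at hq ⊢
      have hle_end : r' ≤ b + m := by
        by_contra! hlt
        refine hq ?_
        have := h_interior (r' - L) ⟨by linarith, by linarith [hr'.2]⟩
        rwa [hper.sub_eq] at this
      refine ⟨r' - b, ⟨by linarith [hr'.1], by linarith [norm_nonneg w]⟩, ?_⟩
      rw [hhg _ ⟨by linarith [hr'.1], by linarith⟩]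
      simp [hg]
  rw [← hD]
  linarith

/-- In a strictly convex space, a curve which is isometric on an interval around `t` runs along
its tangent line at `t`. -/
theorem eq_add_smul_of_isometric {E : Type*} [NormedAddCommGroup E] [NormedSpace ℝ E]
    [StrictConvexSpace ℝ E] {f : ℝ → E} {I : Set ℝ} (hI : Convex ℝ I)
    (hf : ∀ a ∈ I, ∀ b ∈ I, dist (f a) (f b) = dist a b) {t s : ℝ} (ht : t ∈ I) (hs : s ∈ I)
    {v : E} (hv : HasDerivAt f v t) : f s = f t + (s - t) • v := by
  have hline : HasDerivAt (AffineMap.lineMap t s : ℝ → ℝ) (s - t) 0 := AffineMap.hasDerivAt_lineMap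
  have hcomp : HasDerivAt (fun r : ℝ => f (AffineMap.lineMap t s r)) ((s - t) • v) 0 :=
    HasDerivAt.scomp (0 : ℝ) (by simpa using hv) hline
  have haff : HasDerivAt (AffineMap.lineMap (f t) (f s) : ℝ → E) (f s - f t) 0 :=
    AffineMap.hasDerivAt_lineMap
  have heq : ∀ r ∈ Set.Icc (0 : ℝ) 1,
      f (AffineMap.lineMap t s r) = AffineMap.lineMap (f t) (f s) r := by
    intro r hr
    have hmem : AffineMap.lineMap t s r ∈ I := hI.lineMap_mem ht hs hr
    apply eq_lineMap_of_dist_eq_mul_of_dist_eq_mul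
    · rw [hf _ ht _ hmem, hf _ ht _ hs, dist_left_lineMap, Real.norm_of_nonneg hr.1]
    · rw [hf _ hmem _ hs, hf _ ht _ hs, dist_lineMap_right, Real.norm_of_nonneg (by linarith [hr.2])]
  have huniq := (uniqueDiffOn_Icc zero_lt_one (0 : ℝ) ⟨le_rfl, zero_le_one⟩).eq_deriv _
    (hcomp.hasDerivWithinAt (s := Set.Icc 0 1))
    (haff.hasDerivWithinAt.congr heq (heq 0 ⟨le_rfl, zero_le_one⟩))
  rw [huniq]
  abel

/-- Let `γ` be a minimal inspection curve, `t` a regular point of `γ`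
(i.e. `γ` has derivative `v ≠ 0` at `t`), and `ℓ = γ(t) + ℝ·v` the tangent line at `t`.
If `ℓ` meets the interior of the convex hull of `γ`, then some open interval around `t`
is mapped injectively by `γ` into `ℓ ∩ int(conv γ)`. -/
theorem minimal_inspection_tangent_segment
    (L : ℝ) (γ : AddCircle L → E3) (hγ : IsMinInspectionCurve L γ)
    (t : ℝ) (v : E3)
    (hreg : HasDerivAt (liftCurve L γ) v t) (hv : v ≠ 0)
    (hmeets : ({x : E3 | ∃ u : ℝ, x = liftCurve L γ t + u • v} ∩
        interior (convexHull ℝ (Set.range γ))).Nonempty) :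
    ∃ c d : ℝ, c < t ∧ t < d ∧
      Set.InjOn (liftCurve L γ) (Set.Ioo c d) ∧
      ∀ s ∈ Set.Ioo c d,
        liftCurve L γ s ∈ {x : E3 | ∃ u : ℝ, x = liftCurve L γ t + u • v} ∩
          interior (convexHull ℝ (Set.range γ)) := by
  obtain ⟨hL, -, hlip, -, -⟩ := hγ.1
  obtain ⟨_, ⟨u, rfl⟩, hu⟩ := hmeets
  have ht := mem_interior_of_tangent_mem_interior (convex_convexHull ℝ (Set.range γ))
    (fun s => subset_convexHull ℝ _ (Set.mem_range_self (s : AddCircle L))) hreg hu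
  obtain ⟨ε, hε, hball⟩ := Metric.mem_nhds_iff.1
    (hlip.continuous.continuousAt.preimage_mem_nhds (isOpen_interior.mem_nhds ht))
  set δ := min ε (L / 2)
  have hδ : 0 < δ := lt_min hε (half_pos hL)
  have hδε : δ ≤ ε := min_le_left _ _
  have hδL : δ ≤ L / 2 := min_le_right _ _
  have h_interior : ∀ s ∈ Set.Ioo (t - δ) (t + δ),
      liftCurve L γ s ∈ interior (convexHull ℝ (Set.range γ)) := fun s hs =>
    hball (by
      rw [Metric.mem_ball, Real.dist_eq, abs_lt]
      constructor <;> linarith [hs.1, hs.2])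
  have hiso : ∀ a ∈ Set.Ioo (t - δ) (t + δ), ∀ b ∈ Set.Ioo (t - δ) (t + δ),
      dist (liftCurve L γ a) (liftCurve L γ b) = dist a b := by
    intro a ha b hb
    wlog hab : a ≤ b generalizing a b
    · rw [dist_comm, dist_comm a]
      exact this b hb a ha (le_of_not_ge hab)
    rw [dist_comm a, Real.dist_eq, abs_of_nonneg (sub_nonneg.2 hab)]
    exact hγ.dist_eq_of_arc_mem_interior hab (by linarith [ha.1, hb.2]) fun s hs =>
      h_interior s ⟨ha.1.trans hs.1, hs.2.trans hb.2⟩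
  refine ⟨t - δ, t + δ, by linarith, by linarith, fun a ha b hb hab => ?_, fun s hs =>
    ⟨⟨s - t, ?_⟩, h_interior s hs⟩⟩
  · rw [← dist_eq_zero, ← hiso a ha b hb, hab, dist_self]
  · exact eq_add_smul_of_isometric (convex_Ioo _ _) hiso ⟨by linarith, by linarith⟩ hs hreg
end
end
end

section
/- Let γ: ℝ/L → ℝ³ be a minimal inspection curve with unfolding γ̃: [0, L] → ℝ² ≅ ℂ. Then |γ̃'(t)| = 1 for almost every t ∈ [0, L]; in particular γ̃ is parameterized by arclength and L(γ̃) = L(γ). -/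
open Real Set MeasureTheory ENNReal

noncomputable section


noncomputable section

/-- The (almost-everywhere defined) derivative of the radial projection
`γ̄ = γ/|γ| : ℝ → S²` of the lifted curve. -/
def projDeriv (L : ℝ) (γ : AddCircle L → E3) : ℝ → E3 :=
  deriv fun s : ℝ => ‖liftCurve L γ s‖⁻¹ • liftCurve L γ s

/-- The arclength function `θ(t) = ∫₀ᵗ |γ̄'(s)| ds` of the radial projection of `γ`. -/
def thetaFn (L : ℝ) (γ : AddCircle L → E3) (t : ℝ) : ℝ :=
  ∫ u in (0:ℝ)..t, ‖projDeriv L γ u‖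

/-- `γt : [0,L] → ℝ² ≅ ℂ` is the unfolding of `γ : ℝ/L → ℝ³`: for the finitely many times
`0 = t₀ < t₁ < ⋯ < t_m = L` at which `γ` passes through the origin (together with the
distinguished endpoints `0` and `L`), one has
`γt(s) = |γ(s)| · e^{i(θ(s) + (k-1)π)}` for `s ∈ [t_{k-1}, t_k]`. -/
def IsUnfolding (L : ℝ) (γ : AddCircle L → E3) (γt : ℝ → ℂ) : Prop :=
  ∃ (m : ℕ) (tk : ℕ → ℝ), 0 < m ∧ StrictMonoOn tk (Set.Iic m) ∧
    tk 0 = 0 ∧ tk m = L ∧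
    (∀ s ∈ Set.Ioo (0:ℝ) L,
      (liftCurve L γ s = 0 ↔ ∃ k : ℕ, 0 < k ∧ k < m ∧ s = tk k)) ∧
    (∀ k : ℕ, 1 ≤ k → k ≤ m → ∀ s ∈ Set.Icc (tk (k-1)) (tk k),
      γt s = (‖liftCurve L γ s‖ : ℂ) *
        Complex.exp (Complex.I * Complex.ofReal (thetaFn L γ s + ((k : ℝ) - 1) * π)))


open Filter Topology

section Variation

variable {E : Type*} [NormedAddCommGroup E]

theorem eVariationOn_le_of_edist_le {α F G : Type*} [LinearOrder α] [PseudoEMetricSpace F]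
    [PseudoEMetricSpace G] {f : α → F} {g : α → G} {s : Set α}
    (h : ∀ x ∈ s, ∀ y ∈ s, edist (f x) (f y) ≤ edist (g x) (g y)) :
    eVariationOn f s ≤ eVariationOn g s :=
  iSup_mono fun p => Finset.sum_le_sum fun _ _ => h _ (p.2.2.2 _) _ (p.2.2.2 _)

theorem LipschitzOnWith.eVariationOn_Icc_le {X : Type*} [PseudoEMetricSpace X] {f : ℝ → X}
    {a b : ℝ} (hf : LipschitzOnWith 1 f (Icc a b)) :
    eVariationOn f (Icc a b) ≤ ENNReal.ofReal (b - a) := by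
  rcases lt_or_ge b a with hba | hab
  · simp [Icc_eq_empty_of_lt hba]
  refine (eVariationOn_le_of_edist_le (g := fun x : ℝ => x) fun x hx y hy => ?_).trans ?_
  · simpa using hf hx hy
  · have := (monotone_id.monotoneOn (Icc a b)).eVariationOn_eq (left_mem_Icc.2 hab)
      (right_mem_Icc.2 hab)
    rw [inter_self] at this
    exact this.le

theorem LipschitzOnWith.Icc_Icc {X : Type*} [PseudoMetricSpace X] {f : ℝ → X} {K : NNReal}
    {a b c : ℝ} (hab : LipschitzOnWith K f (Icc a b)) (hbc : LipschitzOnWith K f (Icc b c)) :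
    LipschitzOnWith K f (Icc a c) := by
  refine LipschitzOnWith.of_dist_le_mul fun x hx y hy => ?_
  wlog hxy : x ≤ y generalizing x y
  · rw [dist_comm, dist_comm x]
    exact this y hy x hx (le_of_not_ge hxy)
  rcases le_total y b with hyb | hby
  · exact hab.dist_le_mul x ⟨hx.1, hxy.trans hyb⟩ y ⟨hy.1, hyb⟩
  rcases le_total b x with hbx | hxb
  · exact hbc.dist_le_mul x ⟨hbx, hx.2⟩ y ⟨hby, hy.2⟩
  have h1 := hab.dist_le_mul x ⟨hx.1, hxb⟩ b ⟨hx.1.trans hxb, le_rfl⟩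
  have h2 := hbc.dist_le_mul b ⟨le_rfl, hby.trans hy.2⟩ y ⟨hby, hy.2⟩
  rw [Real.dist_eq, abs_of_nonpos (by linarith)] at h1 h2 ⊢
  linarith [dist_triangle (f x) (f b) (f y)]

theorem LipschitzOnWith.lipschitzWith_of_periodic {X : Type*} [PseudoMetricSpace X] {f : ℝ → X}
    {K : NNReal} {P : ℝ} (hP : 0 < P) (hf : LipschitzOnWith K f (Icc 0 P))
    (hper : Function.Periodic f P) : LipschitzWith K f := by
  refine LipschitzWith.of_dist_le_mul fun x y => ?_
  wlog hxy : x ≤ y generalizing x y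
  · rw [dist_comm, dist_comm x]
    exact this y x (le_of_not_ge hxy)
  have key (z : ℝ) : ∃ (n : ℤ) (w : ℝ), w ∈ Ico 0 P ∧ z = w + n * P := by
    refine ⟨⌊z / P⌋, z - ⌊z / P⌋ * P, ⟨?_, ?_⟩, by ring⟩
    · linarith [(le_div_iff₀ hP).1 (Int.floor_le (z / P))]
    · linarith [(div_lt_iff₀ hP).1 (Int.lt_floor_add_one (z / P))]
  obtain ⟨k, u, hu, rfl⟩ := key x
  obtain ⟨j, v, hv, rfl⟩ := key y
  have hfu : f (u + k * P) = f u := hper.int_mul k u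
  have hfv : f (v + j * P) = f v := hper.int_mul j v
  rw [hfu, hfv]
  rcases eq_or_ne k j with rfl | hkj
  · simpa using hf.dist_le_mul u ⟨hu.1, hu.2.le⟩ v ⟨hv.1, hv.2.le⟩
  have hkj' : k + 1 ≤ j := by
    by_contra hlt
    have h1 : j + 1 ≤ k := by omega
    have h2 : ((j : ℝ) + 1) ≤ k := by exact_mod_cast h1
    nlinarith [hu.1, hv.2]
  have h2 : ((k : ℝ) + 1) ≤ j := by exact_mod_cast hkj'
  have h3 := hf.dist_le_mul u ⟨hu.1, hu.2.le⟩ P ⟨hP.le, le_rfl⟩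
  have h4 := hf.dist_le_mul 0 ⟨le_rfl, hP.le⟩ v ⟨hv.1, hv.2.le⟩
  have h5 : f P = f 0 := by simpa using hper 0
  rw [Real.dist_eq, abs_of_nonpos (by linarith [hu.2])] at h3
  rw [Real.dist_eq, abs_of_nonpos (by linarith [hv.1])] at h4
  rw [Real.dist_eq, abs_of_nonpos (by linarith)]
  rw [h5] at h3
  have h6 : (P - u) + v ≤ -(u + k * P - (v + j * P)) := by nlinarith
  have h7 := mul_le_mul_of_nonneg_left h6 K.coe_nonneg
  linarith [dist_triangle (f u) (f 0) (f v)]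

variable [InnerProductSpace ℝ E] [FiniteDimensional ℝ E]

theorem LipschitzOnWith.ae_differentiableAt_Icc {f : ℝ → E} {K : NNReal} {a b : ℝ} (hab : a ≤ b)
    (hf : LipschitzOnWith K f (Icc a b)) : ∀ᵐ x, x ∈ Icc a b → DifferentiableAt ℝ f x := by
  rw [← uIcc_of_le hab] at hf ⊢
  exact hf.absolutelyContinuousOnInterval.boundedVariationOn.ae_differentiableAt_of_mem_uIcc

theorem LipschitzOnWith.intervalIntegrable_norm_deriv {f : ℝ → E} {K : NNReal} {a b : ℝ}
    (hab : a ≤ b) (hf : LipschitzOnWith K f (Icc a b)) :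
    IntervalIntegrable (fun x => ‖deriv f x‖) volume a b := by
  borelize E
  rw [intervalIntegrable_iff_integrableOn_Ioo_of_le hab]
  refine Measure.integrableOn_of_bounded (M := K) (by simp)
    (measurable_deriv f).norm.aestronglyMeasurable ?_
  refine (ae_restrict_iff' measurableSet_Ioo).2 (Eventually.of_forall fun x hx => ?_)
  rw [norm_norm]
  exact norm_deriv_le_of_lipschitzOn (Icc_mem_nhds hx.1 hx.2) hf

theorem LipschitzOnWith.norm_sub_le_integral_norm_deriv {f : ℝ → E} {K : NNReal} {a b : ℝ}
    (hab : a ≤ b) (hf : LipschitzOnWith K f (Icc a b)) :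
    ‖f b - f a‖ ≤ ∫ x in a..b, ‖deriv f x‖ := by
  set w := f b - f a with hw
  rcases eq_or_ne w 0 with h0 | h0
  · rw [h0, norm_zero]
    exact intervalIntegral.integral_nonneg hab fun _ _ => norm_nonneg _
  have hg : AbsolutelyContinuousOnInterval (fun x => inner ℝ w (f x)) a b := by
    refine LipschitzOnWith.absolutelyContinuousOnInterval (K := ‖innerSL ℝ w‖₊ * K) ?_
    rw [uIcc_of_le hab]
    exact (innerSL ℝ w).lipschitz.comp_lipschitzOnWith hf
  have h1 : ∫ x in a..b, deriv (fun x => inner ℝ w (f x)) x = ‖w‖ ^ 2 := by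
    rw [hg.integral_deriv_eq_sub, ← inner_sub_right, ← hw, real_inner_self_eq_norm_sq]
  have h2 : ∫ x in a..b, deriv (fun x => inner ℝ w (f x)) x ≤ ∫ x in a..b, ‖w‖ * ‖deriv f x‖ := by
    refine intervalIntegral.integral_mono_ae_restrict hab hg.intervalIntegrable_deriv
      ((hf.intervalIntegrable_norm_deriv hab).const_mul _) ?_
    refine (ae_restrict_iff' measurableSet_Icc).2 ?_
    filter_upwards [hf.ae_differentiableAt_Icc hab] with x hx hxI
    have h3 : HasDerivAt (fun x => inner ℝ w (f x)) (inner ℝ w (deriv f x)) x :=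
      (innerSL ℝ w).hasFDerivAt.comp_hasDerivAt x (hx hxI).hasDerivAt
    rw [h3.deriv]
    exact real_inner_le_norm _ _
  rw [h1, intervalIntegral.integral_const_mul, sq] at h2
  exact le_of_mul_le_mul_left h2 (norm_pos_iff.2 h0)

theorem LipschitzOnWith.eVariationOn_le_integral_norm_deriv {f : ℝ → E} {K : NNReal} {a b : ℝ}
    (hab : a ≤ b) (hf : LipschitzOnWith K f (Icc a b)) :
    eVariationOn f (Icc a b) ≤ ENNReal.ofReal (∫ x in a..b, ‖deriv f x‖) := by
  have hint (x) (hx : x ∈ Icc a b) (y) (hy : y ∈ Icc a b) :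
      IntervalIntegrable (fun x => ‖deriv f x‖) volume x y :=
    (hf.intervalIntegrable_norm_deriv hab).mono_set (by
      rw [uIcc_of_le hab]; exact OrdConnected.uIcc_subset ordConnected_Icc hx hy)
  have ha : a ∈ Icc a b := left_mem_Icc.2 hab
  set F : ℝ → ℝ := fun x => ∫ u in a..x, ‖deriv f u‖ with hF
  have hFsub (x) (hx : x ∈ Icc a b) (y) (hy : y ∈ Icc a b) :
      F y - F x = ∫ u in x..y, ‖deriv f u‖ :=
    intervalIntegral.integral_interval_sub_left (hint a ha y hy) (hint a ha x hx)
  have hle (x) (hx : x ∈ Icc a b) (y) (hy : y ∈ Icc a b) (hxy : x ≤ y) :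
      dist (f x) (f y) ≤ F y - F x := by
    rw [hFsub x hx y hy, dist_comm, dist_eq_norm]
    exact (hf.mono (Icc_subset_Icc hx.1 hy.2)).norm_sub_le_integral_norm_deriv hxy
  have hmono : MonotoneOn F (Icc a b) := fun x hx y hy hxy => by
    linarith [hle x hx y hy hxy, dist_nonneg (x := f x) (y := f y)]
  refine (eVariationOn_le_of_edist_le (g := F) fun x hx y hy => ?_).trans ?_
  · rw [edist_dist, edist_dist]
    refine ENNReal.ofReal_le_ofReal ?_
    wlog hxy : x ≤ y generalizing x y
    · rw [dist_comm, dist_comm (F x)]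
      exact this y hy x hx (le_of_not_ge hxy)
    refine (hle x hx y hy hxy).trans ?_
    rw [dist_comm, Real.dist_eq]
    exact le_abs_self _
  · have := (hmono.eVariationOn_eq ha (right_mem_Icc.2 hab)).le
    simpa [hF] using this

theorem LipschitzOnWith.integral_norm_deriv_le_eVariationOn {f : ℝ → E} {K : NNReal} {a b : ℝ}
    (hab : a ≤ b) (hf : LipschitzOnWith K f (Icc a b)) :
    ENNReal.ofReal (∫ x in a..b, ‖deriv f x‖) ≤ eVariationOn f (Icc a b) := by
  have hloc : LocallyBoundedVariationOn f (Icc a b) := hf.locallyBoundedVariationOn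
  have ha : a ∈ Icc a b := left_mem_Icc.2 hab
  have hb : b ∈ Icc a b := right_mem_Icc.2 hab
  set V := variationOnFromTo f (Icc a b) a with hV
  have hmono : MonotoneOn V (Icc a b) := variationOnFromTo.monotoneOn hloc ha
  have hmono' : MonotoneOn V (uIcc a b) := by rwa [uIcc_of_le hab]
  have hVa : V a = 0 := variationOnFromTo.self _ _ _
  have hVb : V b = (eVariationOn f (Icc a b)).toReal := by
    rw [hV, variationOnFromTo.eq_of_le _ _ hab, inter_self]
  have h1 : ∫ x in a..b, deriv V x ≤ V b := by
    have := hmono'.intervalIntegral_deriv_mem_uIcc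
    rw [hVa, sub_zero, uIcc_of_le (hVb ▸ ENNReal.toReal_nonneg)] at this
    exact this.2
  have h2 : ∫ x in a..b, ‖deriv f x‖ ≤ ∫ x in a..b, deriv V x := by
    rw [intervalIntegral.integral_of_le hab, intervalIntegral.integral_of_le hab,
      integral_Ioc_eq_integral_Ioo, integral_Ioc_eq_integral_Ioo]
    refine integral_mono_ae
      ((intervalIntegrable_iff_integrableOn_Ioo_of_le hab).1 (hf.intervalIntegrable_norm_deriv hab))
      ((intervalIntegrable_iff_integrableOn_Ioo_of_le hab).1 hmono'.intervalIntegrable_deriv) ?_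
    refine (ae_restrict_iff' measurableSet_Ioo).2 ?_
    filter_upwards [hf.ae_differentiableAt_Icc hab, hmono.ae_differentiableWithinAt_of_mem]
      with x hfx hVx hx
    have hxI := Ioo_subset_Icc_self hx
    have hVd := (hVx hxI).differentiableAt (Icc_mem_nhds hx.1 hx.2)
    have t1 := ((hasDerivAt_iff_tendsto_slope.1 (hfx hxI).hasDerivAt).mono_left
      (nhdsWithin_mono x (fun y (hy : y ∈ Ioi x) => ne_of_gt hy))).norm
    have t2 := (hasDerivAt_iff_tendsto_slope.1 hVd.hasDerivAt).mono_left
      (nhdsWithin_mono x (fun y (hy : y ∈ Ioi x) => ne_of_gt hy))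
    refine le_of_tendsto_of_tendsto t1 t2 ?_
    filter_upwards [Ioo_mem_nhdsGT hx.2] with y hy
    have hyI : y ∈ Icc a b := ⟨hx.1.le.trans hy.1.le, hy.2.le⟩
    have hyx : 0 < y - x := sub_pos.2 hy.1
    have h3 : ‖f y - f x‖ ≤ V y - V x := by
      rw [hV, variationOnFromTo.sub_right hloc ha hyI hxI,
        variationOnFromTo.eq_of_le _ _ hy.1.le, ← dist_eq_norm]
      exact (hloc x y hxI hyI).dist_le ⟨hyI, hy.1.le, le_rfl⟩ ⟨hxI, le_rfl, hy.1.le⟩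
    rw [slope_def_module, slope_def_module, norm_smul, norm_inv, Real.norm_of_nonneg hyx.le,
      smul_eq_mul]
    exact mul_le_mul_of_nonneg_left h3 (inv_nonneg.2 hyx.le)
  rw [← ENNReal.ofReal_toReal (a := eVariationOn f (Icc a b))
    (by simpa [BoundedVariationOn] using hloc a b ha hb), ← hVb]
  exact ENNReal.ofReal_le_ofReal (h2.trans h1)

end Variation

section ConvexHull

open Metric

/-- If a convex hull contains the unit ball, then the points of the original set of norm at most
`r < 1` are not needed to generate it. -/
theorem convexHull_subset_convexHull_of_closedBall_subset {E : Type*} [NormedAddCommGroup E]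
    [NormedSpace ℝ E] [FiniteDimensional ℝ E] [Nontrivial E] {S T : Set E} {r : ℝ} (hr : r < 1)
    (hball : closedBall (0 : E) 1 ⊆ convexHull ℝ S) (hT : ∀ x ∈ S, r < ‖x‖ → x ∈ T) :
    convexHull ℝ S ⊆ convexHull ℝ T := by
  classical
  intro p hp
  obtain ⟨u, hu1, hu2⟩ :=
    (convex_closedBall (0 : E) r).exists_subset_interior_convexHull_finset_of_isCompact
      (isCompact_closedBall _ _) (t := ball 0 1)
      (isOpen_ball.mem_nhdsSet.2 (closedBall_subset_ball hr))
  have hsub : ∀ x ∈ insert p u, ∃ F : Finset E, (F : Set E) ⊆ S ∧ x ∈ convexHull ℝ (F : Set E) := by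
    intro x hx
    have hxS : x ∈ convexHull ℝ S := by
      rcases Finset.mem_insert.1 hx with rfl | hx
      · exact hp
      · exact hball (ball_subset_closedBall (hu2 (subset_convexHull ℝ _ hx)))
    rw [convexHull_eq_union_convexHull_finite_subsets] at hxS
    simpa using hxS
  choose! t ht1 ht2 using hsub
  set F : Finset E := (insert p u).biUnion t with hF
  have hFS : (F : Set E) ⊆ S := by
    intro x hx
    obtain ⟨y, hy, hxy⟩ := Finset.mem_biUnion.1 (Finset.mem_coe.1 hx)
    exact ht1 y hy hxy
  have hmem : ∀ x ∈ insert p u, x ∈ convexHull ℝ (F : Set E) := fun x hx =>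
    convexHull_mono (Finset.coe_subset.2 (Finset.subset_biUnion_of_mem t hx)) (ht2 x hx)
  have huF : convexHull ℝ (u : Set E) ⊆ convexHull ℝ (F : Set E) :=
    convexHull_min (fun x hx => hmem x (Finset.mem_insert_of_mem hx)) (convex_convexHull ℝ _)
  have hext : (convexHull ℝ (F : Set E)).extremePoints ℝ ⊆ T := by
    intro x hx
    have hxF : x ∈ F := extremePoints_convexHull_subset hx
    refine hT x (hFS hxF) ?_
    by_contra! hxr
    exact (disjoint_interior_extremePoints _).notMem_of_mem_left
      (interior_mono huF (hu1 (mem_closedBall_zero_iff.2 hxr))) hx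
  have hfin : ((convexHull ℝ (F : Set E)).extremePoints ℝ).Finite :=
    F.finite_toSet.subset extremePoints_convexHull_subset
  have hkm := closure_convexHull_extremePoints (F.finite_toSet.isCompact_convexHull ℝ)
    (convex_convexHull ℝ (F : Set E))
  rw [(hfin.isClosed_convexHull ℝ).closure_eq] at hkm
  have hpF := hmem p (Finset.mem_insert_self p u)
  rw [← hkm] at hpF
  exact convexHull_mono hext hpF

end ConvexHull

section InspectionCurve

variable {L : ℝ} {γ : AddCircle L → E3}

theorem liftCurve_periodic (L : ℝ) (γ : AddCircle L → E3) :
    Function.Periodic (liftCurve L γ) L := fun s => by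
  simp [liftCurve]

theorem IsInspectionCurve.le_integral_norm_deriv (hγ : IsInspectionCurve L γ) (b : ℝ) :
    L ≤ ∫ x in b..b + L, ‖deriv (liftCurve L γ) x‖ := by
  obtain ⟨hL, -, hlip, hvar, -⟩ := hγ
  have hper : Function.Periodic (fun x => ‖deriv (liftCurve L γ) x‖) L := fun x => by
    have h := deriv_comp_add_const (liftCurve L γ) L x
    rw [show (fun x => liftCurve L γ (x + L)) = liftCurve L γ from
      funext (liftCurve_periodic L γ)] at h
    simp only [h]
  rw [hper.intervalIntegral_add_eq b 0, zero_add]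
  have h := (hlip.lipschitzOnWith (s := Icc 0 L)).eVariationOn_le_integral_norm_deriv hL.le
  rw [hvar] at h
  exact (ENNReal.ofReal_le_ofReal_iff
    (intervalIntegral.integral_nonneg hL.le fun _ _ => norm_nonneg _)).1 h

theorem IsInspectionCurve.ae_norm_deriv_eq_one (hγ : IsInspectionCurve L γ) :
    ∀ᵐ t, t ∈ Icc 0 L → ‖deriv (liftCurve L γ) t‖ = 1 := by
  have hL := hγ.1
  have hlip := hγ.2.2.1
  have hle (t) : ‖deriv (liftCurve L γ) t‖ ≤ 1 := by
    simpa using norm_deriv_le_of_lipschitz hlip (x₀ := t)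
  have hint := (hlip.lipschitzOnWith (s := Icc 0 L)).intervalIntegrable_norm_deriv hL.le
  have h0 : ∫ x in (0 : ℝ)..L, (1 - ‖deriv (liftCurve L γ) x‖) = 0 := by
    refine le_antisymm ?_ (intervalIntegral.integral_nonneg hL.le fun t _ => sub_nonneg.2 (hle t))
    rw [intervalIntegral.integral_sub (by simp) hint]
    have := hγ.le_integral_norm_deriv 0
    rw [zero_add] at this
    simpa using this
  have hint' : IntervalIntegrable (fun x => 1 - ‖deriv (liftCurve L γ) x‖) volume 0 L :=
    IntervalIntegrable.sub (by simp) hint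
  rw [intervalIntegral.integral_of_le hL.le, ← integral_Icc_eq_integral_Ioc,
    integral_eq_zero_iff_of_nonneg (fun t => sub_nonneg.2 (hle t))
    ((intervalIntegrable_iff_integrableOn_Icc_of_le hL.le).1 hint')] at h0
  filter_upwards [(ae_restrict_iff' measurableSet_Icc).1 h0] with t ht htI
  have := ht htI
  simp only [Pi.zero_apply] at this
  linarith

theorem IsInspectionCurve.le_eVariationOn (hγ : IsInspectionCurve L γ) {a b : ℝ} (hab : a ≤ b)
    (hbL : b ≤ a + L) :
    ENNReal.ofReal (a + L - b) ≤ eVariationOn (liftCurve L γ) (Icc b (a + L)) := by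
  have hlip := hγ.2.2.1
  have h1 := (hlip.lipschitzOnWith (s := Icc b (b + L))).integral_norm_deriv_le_eVariationOn
    (by linarith [hγ.1])
  have h2 := ENNReal.ofReal_le_ofReal (hγ.le_integral_norm_deriv b)
  have h3 := eVariationOn.Icc_add_Icc (liftCurve L γ) (s := univ) hbL
    (show a + L ≤ b + L by linarith) (mem_univ _)
  simp only [univ_inter] at h3
  have h4 := (hlip.lipschitzOnWith (s := Icc (a + L) (b + L))).eVariationOn_Icc_le
  have h5 : ENNReal.ofReal (a + L - b) + ENNReal.ofReal (b + L - (a + L)) ≤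
      eVariationOn (liftCurve L γ) (Icc b (a + L)) + ENNReal.ofReal (b + L - (a + L)) := by
    rw [← ENNReal.ofReal_add (by linarith) (by linarith)]
    calc _ = ENNReal.ofReal L := by ring_nf
      _ ≤ _ := (h2.trans h1).trans (h3 ▸ by gcongr)
  exact (ENNReal.add_le_add_iff_right ENNReal.ofReal_ne_top).1 h5

/-- A minimal inspection curve is straight inside the ball of radius `1/2`, as otherwise replacing
an arc by its chord would produce a shorter inspection curve. -/
theorem IsMinInspectionCurve.sub_le_norm_sub (hγ : IsMinInspectionCurve L γ) {a b : ℝ}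
    (hab : a ≤ b) (hbL : b < a + L) (hball : ∀ t ∈ Icc a b, ‖liftCurve L γ t‖ ≤ 1 / 2) :
    b - a ≤ ‖liftCurve L γ b - liftCurve L γ a‖ := by
  obtain ⟨hins, hmin⟩ := hγ
  have hlip := hins.2.2.1
  set g := liftCurve L γ with hg
  have hper : Function.Periodic g L := liftCurve_periodic L γ
  set d := ‖g b - g a‖ with hd
  have hd0 : 0 ≤ d := norm_nonneg _
  set P := a + L - b with hP
  have hP0 : 0 < P := by linarith
  set F : ℝ → E3 := fun s => if s ≤ P then g (b + s) else g a + ((s - P) / d) • (g b - g a)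
    with hF
  have hbP : g (b + P) = g a := by rw [hP, add_sub_cancel, hper]
  have hF1 : EqOn F (fun s => g (b + s)) (Icc 0 P) := fun s hs => if_pos hs.2
  have hF2 : EqOn F (fun s => g a + ((s - P) / d) • (g b - g a)) (Icc P (P + d)) := by
    intro s hs
    rcases hs.1.eq_or_lt with h | h
    · simp [hF, ← h, hbP]
    · exact if_neg h.not_ge
  have hFend : F (P + d) = g b := by
    rw [hF2 ⟨by linarith, le_rfl⟩]
    rcases hd0.eq_or_lt with h | h
    · have : g b - g a = 0 := norm_eq_zero.1 (hd ▸ h.symm)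
      simp [← sub_eq_zero.1 this]
    · simp [h.ne']
  have hF0 : F 0 = g b := by rw [hF1 ⟨le_rfl, hP0.le⟩]; simp
  have hFP : F P = g a := by rw [hF1 ⟨hP0.le, le_rfl⟩]; exact hbP
  have hlip1 : LipschitzOnWith 1 F (Icc 0 P) := by
    refine LipschitzOnWith.of_dist_le_mul fun x hx y hy => ?_
    rw [hF1 hx, hF1 hy]
    simpa using hlip.dist_le_mul (b + x) (b + y)
  have hlip2 : LipschitzOnWith 1 F (Icc P (P + d)) := by
    refine LipschitzOnWith.of_dist_le_mul fun x hx y hy => ?_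
    rw [hF2 hx, hF2 hy, dist_add_left, dist_eq_norm, ← sub_smul, norm_smul, ← hd, ← sub_div,
      sub_sub_sub_cancel_right, norm_div, Real.norm_of_nonneg hd0, Real.dist_eq, Real.norm_eq_abs,
      NNReal.coe_one, one_mul]
    rcases hd0.eq_or_lt with h | h
    · simp [← h]
    · rw [div_mul_cancel₀ _ h.ne']
  have hlipF := hlip1.Icc_Icc hlip2
  set M := P + d with hM
  have hM0 : 0 < M := by linarith
  have : Fact (0 < M) := ⟨hM0⟩
  set γ' : AddCircle M → E3 := AddCircle.liftIco M 0 F with hγ'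
  have heq : EqOn (liftCurve M γ') F (Icc 0 M) := by
    intro s hs
    rcases hs.2.eq_or_lt with h | h
    · rw [h, hFend, ← hF0, (liftCurve_periodic M γ').eq]
      exact AddCircle.liftIco_zero_coe_apply ⟨le_rfl, hM0⟩
    · exact AddCircle.liftIco_zero_coe_apply ⟨hs.1, h⟩
  have hlipγ' : LipschitzOnWith 1 (liftCurve M γ') (Icc 0 M) := fun x hx y hy => by
    rw [heq hx, heq hy]
    exact hlipF hx hy
  have hins' : IsInspectionCurve M γ' := by
    refine ⟨hM0, AddCircle.liftIco_zero_continuous (hF0.trans hFend.symm) hlipF.continuousOn,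
      hlipγ'.lipschitzWith_of_periodic hM0 (liftCurve_periodic M γ'), ?_, ?_⟩
    · refine le_antisymm (by simpa using hlipγ'.eVariationOn_Icc_le) ?_
      rw [eVariationOn.eq_of_eqOn heq]
      have h1 := eVariationOn.Icc_add_Icc F (s := univ) hP0.le (show P ≤ M by linarith)
        (mem_univ _)
      simp only [univ_inter] at h1
      rw [← h1, hM, ENNReal.ofReal_add hP0.le hd0]
      refine add_le_add ?_ ?_
      · rw [eVariationOn.eq_of_eqOn hF1]
        have h2 := eVariationOn.comp_eq_of_monotoneOn g (t := Icc 0 P) (fun s => b + s)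
          (fun x _ y _ hxy => by simpa using hxy)
        have h3 : (fun s => b + s) '' Icc 0 P = Icc b (a + L) := by
          rw [image_const_add_Icc, hP]; simp
        rw [h3] at h2
        exact (hins.le_eVariationOn hab hbL.le).trans h2.ge
      · refine le_trans ?_ (eVariationOn.edist_le F (x := P + d) (y := P)
          ⟨by linarith, le_rfl⟩ ⟨le_rfl, by linarith⟩)
        rw [hFend, hFP, edist_dist, dist_eq_norm]
    · refine hins.2.2.2.2.trans
        (convexHull_subset_convexHull_of_closedBall_subset (r := 1 / 2) (by norm_num) ?_ ?_)
      · rw [← convexHull_sphere_eq_closedBall (0 : E3) zero_le_one]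
        exact convexHull_min hins.2.2.2.2 (convex_convexHull ℝ _)
      · rintro _ ⟨q, rfl⟩ hq
        have : Fact (0 < L) := ⟨hins.1⟩
        obtain ⟨t, ht, rfl⟩ : q ∈ ((↑) : ℝ → AddCircle L) '' Ico a (a + L) := by
          rw [AddCircle.coe_image_Ico_eq]; trivial
        have htb : b < t := by
          by_contra! h
          exact absurd (hball t ⟨ht.1, h⟩) (not_le.2 hq)
        have hs : t - b ∈ Icc 0 P := ⟨by linarith, by linarith [ht.2]⟩
        refine ⟨((t - b : ℝ) : AddCircle M), ?_⟩
        have h1 := heq (show t - b ∈ Icc 0 M from ⟨hs.1, by linarith [hs.2]⟩)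
        rw [hF1 hs] at h1
        simpa [liftCurve, hg] using h1
  have := hmin M γ' hins'
  linarith

end InspectionCurve

section ProjDeriv

variable {L : ℝ} {γ : AddCircle L → E3}

theorem exists_eventually_norm_projDeriv_le_of_ne_zero (hlip : LipschitzWith 1 (liftCurve L γ))
    {x : ℝ} (hx : liftCurve L γ x ≠ 0) : ∃ C, ∀ᶠ u in 𝓝 x, ‖projDeriv L γ u‖ ≤ C := by
  have hN : ContDiffAt ℝ 1 (fun y : E3 => ‖y‖⁻¹ • y) (liftCurve L γ x) :=
    ((contDiffAt_norm ℝ hx).inv (norm_ne_zero_iff.2 hx)).smul contDiffAt_id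
  obtain ⟨K, t, ht, hK⟩ := hN.exists_lipschitzOnWith
  have hpre : liftCurve L γ ⁻¹' t ∈ 𝓝 x := hlip.continuous.continuousAt ht
  refine ⟨K, ?_⟩
  filter_upwards [eventually_mem_nhds_iff.2 hpre] with u hu
  refine norm_deriv_le_of_lipschitzOn hu ?_
  simpa [Function.comp_def] using hK.comp (hlip.lipschitzOnWith (s := liftCurve L γ ⁻¹' t))
    (mapsTo_preimage _ _)

/-- A minimal inspection curve passes through the origin along a straight segment. -/
theorem IsMinInspectionCurve.norm_sub_eq_of_near_zero (hγ : IsMinInspectionCurve L γ) {x s t : ℝ}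
    (hx : liftCurve L γ x = 0) (hs : |s - x| < min (1 / 2) (L / 4))
    (ht : |t - x| < min (1 / 2) (L / 4)) :
    ‖liftCurve L γ s - liftCurve L γ t‖ = |s - t| := by
  wlog hst : t ≤ s generalizing s t
  · rw [norm_sub_rev, abs_sub_comm]
    exact this ht hs (le_of_not_ge hst)
  have hlip := hγ.1.2.2.1
  have hL := hγ.1.1
  obtain ⟨hs1, hs2⟩ := lt_min_iff.1 hs
  obtain ⟨ht1, ht2⟩ := lt_min_iff.1 ht
  rw [abs_lt] at hs1 hs2 ht1 ht2
  refine le_antisymm ?_ ?_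
  · simpa [dist_eq_norm] using hlip.dist_le_mul s t
  · rw [abs_of_nonneg (sub_nonneg.2 hst)]
    refine hγ.sub_le_norm_sub hst (by linarith) fun u hu => ?_
    have h := hlip.dist_le_mul u x
    rw [dist_eq_norm, hx, sub_zero, Real.dist_eq, NNReal.coe_one, one_mul] at h
    exact h.trans (abs_le.2 ⟨by linarith [hu.1], by linarith [hu.2]⟩)

theorem IsMinInspectionCurve.eventually_projDeriv_eq_zero (hγ : IsMinInspectionCurve L γ) {x : ℝ}
    (hx : liftCurve L γ x = 0) : ∀ᶠ u in 𝓝 x, u ≠ x → projDeriv L γ u = 0 := by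
  have hL := hγ.1.1
  have hε : 0 < min (1 / 2) (L / 4) := by positivity
  filter_upwards [Metric.ball_mem_nhds x hε] with u hu hux
  rw [Metric.mem_ball, Real.dist_eq] at hu
  have hnorm : ∀ s, |s - x| < min (1 / 2) (L / 4) → ‖liftCurve L γ s‖ = |s - x| := fun s hs => by
    simpa [hx] using hγ.norm_sub_eq_of_near_zero hx hs (t := x) (by simpa using hε)
  have hsign : 0 < (u - x) * (u - x) := mul_self_pos.2 (sub_ne_zero.2 hux)
  have hev : ∀ᶠ s in 𝓝 u, |s - x| < min (1 / 2) (L / 4) ∧ 0 < (s - x) * (u - x) :=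
    (((by fun_prop : Continuous fun s => |s - x|).tendsto u).eventually_lt_const hu).and
      (((by fun_prop : Continuous fun s => (s - x) * (u - x)).tendsto u).eventually_const_lt hsign)
  have hconst : (fun s => ‖liftCurve L γ s‖⁻¹ • liftCurve L γ s) =ᶠ[𝓝 u]
      fun _ => ‖liftCurve L γ u‖⁻¹ • liftCurve L γ u := by
    filter_upwards [hev] with s hs
    have hsx : s - x ≠ 0 := left_ne_zero_of_mul hs.2.ne'
    refine (sameRay_iff_inv_norm_smul_eq_of_ne ?_ ?_).1 (sameRay_iff_norm_sub.2 ?_)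
    · rw [← norm_ne_zero_iff, hnorm s hs.1]
      exact abs_ne_zero.2 hsx
    · rw [← norm_ne_zero_iff, hnorm u hu]
      exact abs_ne_zero.2 (sub_ne_zero.2 hux)
    · rw [hγ.norm_sub_eq_of_near_zero hx hs.1 hu, hnorm s hs.1, hnorm u hu]
      rcases pos_and_pos_or_neg_and_neg_of_mul_pos hs.2 with ⟨h1, h2⟩ | ⟨h1, h2⟩
      · rw [abs_of_pos h1, abs_of_pos h2, sub_sub_sub_cancel_right]
      · rw [abs_of_neg h1, abs_of_neg h2, neg_sub_neg, sub_sub_sub_cancel_right, abs_sub_comm]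
  rw [projDeriv, hconst.deriv_eq, deriv_const]

theorem IsMinInspectionCurve.exists_norm_projDeriv_le (hγ : IsMinInspectionCurve L γ) (a b : ℝ) :
    ∃ C : NNReal, ∀ u ∈ Icc a b, ‖projDeriv L γ u‖ ≤ C := by
  suffices h : ∃ C : ℝ, ∀ u ∈ Icc a b, ‖projDeriv L γ u‖ ≤ C by
    obtain ⟨C, hC⟩ := h
    exact ⟨C.toNNReal, fun u hu => (hC u hu).trans (Real.le_coe_toNNReal C)⟩
  refine isCompact_Icc.induction_on (p := fun S => ∃ C : ℝ, ∀ u ∈ S, ‖projDeriv L γ u‖ ≤ C)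
    (by simp) ?_ ?_ ?_
  · rintro S T hST ⟨C, hC⟩
    exact ⟨C, fun u hu => hC u (hST hu)⟩
  · rintro S T ⟨C, hC⟩ ⟨D, hD⟩
    refine ⟨max C D, ?_⟩
    rintro u (hu | hu)
    · exact (hC u hu).trans (le_max_left _ _)
    · exact (hD u hu).trans (le_max_right _ _)
  · intro x _
    suffices h : ∃ C, ∀ᶠ u in 𝓝 x, ‖projDeriv L γ u‖ ≤ C by
      obtain ⟨C, hC⟩ := h
      exact ⟨_, mem_nhdsWithin_of_mem_nhds hC, C, fun u hu => hu⟩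
    by_cases hx : liftCurve L γ x = 0
    · refine ⟨‖projDeriv L γ x‖, ?_⟩
      filter_upwards [hγ.eventually_projDeriv_eq_zero hx] with u hu
      by_cases hux : u = x
      · rw [hux]
      · rw [hu hux, norm_zero]
        exact norm_nonneg _
    · exact exists_eventually_norm_projDeriv_le_of_ne_zero hγ.1.2.2.1 hx

theorem IsMinInspectionCurve.intervalIntegrable_norm_projDeriv (hγ : IsMinInspectionCurve L γ)
    (a b : ℝ) : IntervalIntegrable (fun u => ‖projDeriv L γ u‖) volume a b := by
  obtain ⟨C, hC⟩ := hγ.exists_norm_projDeriv_le (min a b) (max a b)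
  refine (intervalIntegrable_const (c := (C : ℝ))).mono_fun
    (measurable_deriv _).norm.aestronglyMeasurable ?_
  refine (ae_restrict_iff' measurableSet_uIoc).2 (Eventually.of_forall fun u hu => ?_)
  simpa using hC u (uIoc_subset_uIcc hu)

theorem IsMinInspectionCurve.exists_lipschitzOnWith_thetaFn (hγ : IsMinInspectionCurve L γ)
    (a b : ℝ) : ∃ C : NNReal, LipschitzOnWith C (thetaFn L γ) (Icc a b) := by
  obtain ⟨C, hC⟩ := hγ.exists_norm_projDeriv_le a b
  refine ⟨C, LipschitzOnWith.of_dist_le_mul fun x hx y hy => ?_⟩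
  rw [dist_eq_norm, thetaFn, thetaFn, intervalIntegral.integral_interval_sub_left
    (hγ.intervalIntegrable_norm_projDeriv _ _) (hγ.intervalIntegrable_norm_projDeriv _ _)]
  refine intervalIntegral.norm_integral_le_of_norm_le_const fun u hu => ?_
  rw [norm_norm]
  exact hC u (uIcc_subset_Icc hy hx (uIoc_subset_uIcc hu))

theorem IsMinInspectionCurve.ae_hasDerivAt_thetaFn (hγ : IsMinInspectionCurve L γ) :
    ∀ᵐ t, t ∈ Icc 0 L → HasDerivAt (thetaFn L γ) ‖projDeriv L γ t‖ t := by
  filter_upwards [(hγ.intervalIntegrable_norm_projDeriv 0 L).ae_hasDerivAt_integral] with t ht htL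
  rw [uIcc_of_le hγ.1.1.le] at ht
  exact ht htL 0 ⟨le_rfl, hγ.1.1.le⟩

end ProjDeriv

section Polar

/-- In polar coordinates, a curve has the same speed as the planar curve with the same radius and
the same angular speed. -/
theorem exists_hasDerivAt_polar {E : Type*} [NormedAddCommGroup E] [InnerProductSpace ℝ E]
    {g : ℝ → E} {v : E} {θ : ℝ → ℝ} {t : ℝ} (hg : HasDerivAt g v t) (hg0 : g t ≠ 0)
    (hθ : HasDerivAt θ ‖deriv (fun s => ‖g s‖⁻¹ • g s) t‖ t) (c : ℝ) :
    ∃ w : ℂ, HasDerivAt (fun s => (‖g s‖ : ℂ) *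
      Complex.exp (Complex.I * Complex.ofReal (θ s + c))) w t ∧ ‖w‖ = ‖v‖ := by
  have hr0 : ‖g t‖ ≠ 0 := norm_ne_zero_iff.2 hg0
  obtain ⟨r', hr'⟩ : ∃ r', HasDerivAt (fun s => ‖g s‖) r' t :=
    ⟨_, (hg.differentiableAt.norm ℝ hg0).hasDerivAt⟩
  have hbar : HasDerivAt (fun s => ‖g s‖⁻¹ • g s) (‖g t‖⁻¹ • v + (-r' / ‖g t‖ ^ 2) • g t) t :=
    (hr'.inv hr0).smul hg
  have hinner : inner ℝ (g t) v = ‖g t‖ * r' := by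
    have h1 := hg.norm_sq.unique (hr'.pow 2)
    simp only [Nat.cast_ofNat, Nat.add_one_sub_one, pow_one] at h1
    linarith
  rw [hbar.deriv] at hθ
  set ω := ‖‖g t‖⁻¹ • v + (-r' / ‖g t‖ ^ 2) • g t‖ with hω
  have hω2 : ω ^ 2 = (‖v‖ ^ 2 - r' ^ 2) / ‖g t‖ ^ 2 := by
    rw [hω, norm_add_sq_real, norm_smul, norm_smul, inner_smul_left, inner_smul_right,
      real_inner_comm, hinner, mul_pow, mul_pow, Real.norm_eq_abs, Real.norm_eq_abs, sq_abs, sq_abs]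
    simp only [conj_trivial]
    field_simp
    ring
  have hvnorm : ‖v‖ ^ 2 = r' ^ 2 + (‖g t‖ * ω) ^ 2 := by
    rw [mul_pow, hω2]
    field_simp
    ring
  have hw := hr'.ofReal_comp.mul
    (((hθ.add_const c).ofReal_comp.const_mul Complex.I).cexp)
  refine ⟨_, hw, ?_⟩
  rw [← sq_eq_sq₀ (norm_nonneg _) (norm_nonneg _), hvnorm]
  have hfac (e : ℂ) : (r' : ℂ) * e + ‖g t‖ * (e * (Complex.I * ω)) =
      (r' + (‖g t‖ * ω : ℝ) * Complex.I) * e := by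
    push_cast
    ring
  rw [hfac, norm_mul, mul_comm Complex.I, Complex.norm_exp_ofReal_mul_I, mul_one, Complex.sq_norm,
    Complex.normSq_add_mul_I]

theorem norm_polar_sub_polar_le (r r' α β : ℝ) :
    ‖(r : ℂ) * Complex.exp (Complex.I * (α : ℝ)) - r' * Complex.exp (Complex.I * (β : ℝ))‖
      ≤ |r - r'| + |r'| * |α - β| := by
  have h : (r : ℂ) * Complex.exp (Complex.I * (α : ℝ)) - r' * Complex.exp (Complex.I * (β : ℝ)) =
      ((r - r' : ℝ) : ℂ) * Complex.exp (Complex.I * (α : ℝ)) +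
        r' * (Complex.exp (Complex.I * (β : ℝ)) *
          (Complex.exp (Complex.I * ((α - β : ℝ) : ℂ)) - 1)) := by
    rw [mul_sub, ← Complex.exp_add]
    push_cast
    ring_nf
  have h1 (x : ℝ) : ‖Complex.exp (Complex.I * x)‖ = 1 := by
    rw [mul_comm, Complex.norm_exp_ofReal_mul_I]
  rw [h]
  refine (norm_add_le _ _).trans ?_
  rw [norm_mul, norm_mul, norm_mul, h1, h1, Complex.norm_real, Complex.norm_real, mul_one, one_mul]
  gcongr
  · rfl
  · rfl
  · exact Real.norm_exp_I_mul_ofReal_sub_one_le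

end Polar

section Unfolding

variable {L : ℝ} {γ : AddCircle L → E3} {γt : ℝ → ℂ} {m : ℕ} {tk : ℕ → ℝ}

theorem exists_mem_Ioo_of_forall_ne {t : ℝ} (h0 : tk 0 ≤ t) (hm : t ≤ tk m)
    (hne : ∀ k ≤ m, t ≠ tk k) : ∃ k, 1 ≤ k ∧ k ≤ m ∧ t ∈ Ioo (tk (k - 1)) (tk k) := by
  have hex : ∃ k, t ≤ tk k := ⟨m, hm⟩
  have hkm : Nat.find hex ≤ m := Nat.find_min' hex hm
  have hk0 : Nat.find hex ≠ 0 := fun h => by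
    have h1 := Nat.find_spec hex
    rw [h] at h1
    exact hne 0 (Nat.zero_le m) (le_antisymm h1 h0)
  refine ⟨Nat.find hex, Nat.one_le_iff_ne_zero.2 hk0, hkm, ?_, ?_⟩
  · exact not_le.1 (Nat.find_min hex (Nat.sub_lt (Nat.pos_of_ne_zero hk0) one_pos))
  · exact (Nat.find_spec hex).lt_of_ne (hne _ hkm)

theorem IsMinInspectionCurve.ae_exists_hasDerivAt_of_isUnfolding (hγ : IsMinInspectionCurve L γ)
    (htk0 : tk 0 = 0) (htkm : tk m = L)
    (hzero : ∀ s ∈ Ioo (0 : ℝ) L,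
      (liftCurve L γ s = 0 ↔ ∃ k : ℕ, 0 < k ∧ k < m ∧ s = tk k))
    (hform : ∀ k : ℕ, 1 ≤ k → k ≤ m → ∀ s ∈ Icc (tk (k - 1)) (tk k),
      γt s = (‖liftCurve L γ s‖ : ℂ) *
        Complex.exp (Complex.I * Complex.ofReal (thetaFn L γ s + ((k : ℝ) - 1) * π))) :
    ∀ᵐ t, t ∈ Icc 0 L → ∃ v : ℂ, HasDerivAt γt v t ∧ ‖v‖ = 1 := by
  have hnull : ∀ᵐ t, t ∉ tk '' Iic m :=
    measure_eq_zero_iff_ae_notMem.1 (((finite_Iic m).image tk).measure_zero volume)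
  filter_upwards [hnull, hγ.ae_hasDerivAt_thetaFn, hγ.1.ae_norm_deriv_eq_one] with t htk hθ hv htL
  have hne : ∀ k ≤ m, t ≠ tk k := fun k hk h => htk ⟨k, hk, h.symm⟩
  obtain ⟨k, hk1, hkm, hk⟩ := exists_mem_Ioo_of_forall_ne (htk0 ▸ htL.1) (htkm ▸ htL.2) hne
  have hg0 : liftCurve L γ t ≠ 0 := fun h => by
    have htI : t ∈ Ioo 0 L := ⟨htL.1.lt_of_ne (htk0 ▸ hne 0 (Nat.zero_le m)).symm,
      htL.2.lt_of_ne (htkm ▸ hne m le_rfl)⟩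
    obtain ⟨j, -, hjm, hj⟩ := (hzero t htI).1 h
    exact hne j hjm.le hj
  have hdiff : DifferentiableAt ℝ (liftCurve L γ) t :=
    differentiableAt_of_deriv_ne_zero (norm_ne_zero_iff.1 (by rw [hv htL]; exact one_ne_zero))
  obtain ⟨w, hw, hw1⟩ := exists_hasDerivAt_polar hdiff.hasDerivAt hg0 (hθ htL) (((k : ℝ) - 1) * π)
  refine ⟨w, hw.congr_of_eventuallyEq ?_, hw1.trans (hv htL)⟩
  filter_upwards [Ioo_mem_nhds hk.1 hk.2] with s hs
  exact hform k hk1 hkm s (Ioo_subset_Icc_self hs)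

theorem IsMinInspectionCurve.exists_lipschitzOnWith_of_isUnfolding (hγ : IsMinInspectionCurve L γ)
    (hmono : StrictMonoOn tk (Iic m)) (htk0 : tk 0 = 0) (htkm : tk m = L)
    (hform : ∀ k : ℕ, 1 ≤ k → k ≤ m → ∀ s ∈ Icc (tk (k - 1)) (tk k),
      γt s = (‖liftCurve L γ s‖ : ℂ) *
        Complex.exp (Complex.I * Complex.ofReal (thetaFn L γ s + ((k : ℝ) - 1) * π))) :
    ∃ K : NNReal, LipschitzOnWith K γt (Icc 0 L) := by
  have hlip := hγ.1.2.2.1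
  obtain ⟨C, hC⟩ := hγ.exists_lipschitzOnWith_thetaFn 0 L
  obtain ⟨R, hR⟩ := isCompact_Icc.exists_bound_of_continuousOn
    (hlip.continuous.continuousOn (s := Icc 0 L))
  refine ⟨1 + R.toNNReal * C, ?_⟩
  have hpiece (k : ℕ) (hk : k + 1 ≤ m) :
      LipschitzOnWith (1 + R.toNNReal * C) γt (Icc (tk k) (tk (k + 1))) := by
    have hsub : Icc (tk k) (tk (k + 1)) ⊆ Icc 0 L := by
      rw [← htk0, ← htkm]
      exact Icc_subset_Icc (hmono.monotoneOn (Nat.zero_le m) (by simp; lia) (Nat.zero_le k))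
        (hmono.monotoneOn hk (mem_Iic.2 le_rfl) hk)
    refine LipschitzOnWith.of_dist_le_mul fun x hx y hy => ?_
    rw [hform (k + 1) (by lia) hk x (by simpa using hx), hform (k + 1) (by lia) hk y
      (by simpa using hy), dist_eq_norm]
    refine (norm_polar_sub_polar_le _ _ _ _).trans ?_
    have h1 : |‖liftCurve L γ x‖ - ‖liftCurve L γ y‖| ≤ dist x y :=
      (abs_norm_sub_norm_le _ _).trans (by simpa [dist_eq_norm] using hlip.dist_le_mul x y)
    have h2 : |thetaFn L γ x - thetaFn L γ y| ≤ C * dist x y := by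
      simpa [Real.dist_eq] using hC.dist_le_mul x (hsub hx) y (hsub hy)
    have h3 : ‖liftCurve L γ y‖ ≤ R.toNNReal := (hR y (hsub hy)).trans (Real.le_coe_toNNReal R)
    rw [add_sub_add_right_eq_sub, abs_norm]
    calc _ ≤ dist x y + R.toNNReal * (C * dist x y) := by gcongr
      _ = _ := by push_cast; ring
  have hglue (k : ℕ) (hk : k ≤ m) : LipschitzOnWith (1 + R.toNNReal * C) γt (Icc 0 (tk k)) := by
    induction k with
    | zero => rw [htk0, Icc_self]; exact LipschitzOnWith.of_dist_le_mul (by simp)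
    | succ k ih => exact (ih (by lia)).Icc_Icc (hpiece k hk)
  exact htkm ▸ hglue m le_rfl

end Unfolding

/-- The unfolding `γt` of a minimal inspection curve `γ` (parameterized
so that `0` is a local minimum point of `|γ|`) satisfies `|γt'| = 1` almost everywhere on
`[0, L]`; in particular it is parameterized by arclength and has the same length `L`. -/
theorem unfolding_unit_speed
    (L : ℝ) (γ : AddCircle L → E3) (hγ : IsMinInspectionCurve L γ)
    (h0 : IsLocalMin (fun s : ℝ => ‖liftCurve L γ s‖) 0)
    (γt : ℝ → ℂ) (hunf : IsUnfolding L γ γt) :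
    (∀ᵐ t ∂(volume.restrict (Set.Icc 0 L)),
      ∃ v : ℂ, HasDerivAt γt v t ∧ ‖v‖ = 1) ∧
    eVariationOn γt (Set.Icc 0 L) = ENNReal.ofReal L := by
  obtain ⟨m, tk, -, hmono, htk0, htkm, hzero, hform⟩ := hunf
  have hL : 0 < L := hγ.1.1
  have hae := hγ.ae_exists_hasDerivAt_of_isUnfolding htk0 htkm hzero hform
  obtain ⟨K, hK⟩ := hγ.exists_lipschitzOnWith_of_isUnfolding hmono htk0 htkm hform
  refine ⟨(ae_restrict_iff' measurableSet_Icc).2 hae, ?_⟩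
  have hint : ∫ x in (0 : ℝ)..L, ‖deriv γt x‖ = L := by
    rw [intervalIntegral.integral_congr_ae (g := fun _ => (1 : ℝ))]
    · simp
    · filter_upwards [hae] with t ht htL
      rw [uIoc_of_le hL.le] at htL
      obtain ⟨v, hv, hv1⟩ := ht (Ioc_subset_Icc_self htL)
      rw [hv.deriv, hv1]
  refine le_antisymm ?_ ?_
  · simpa only [hint] using hK.eVariationOn_le_integral_norm_deriv hL.le
  · simpa only [hint] using hK.integral_norm_deriv_le_eVariationOn hL.le
end
end
end
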